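/- Hopf's Umlaufsatz applied in this setting: if γ : [0,L] → ℝ² is a C² unit-speed curve from (a,0) to (-a,0) with positive geodesic curvature, such that γ ⊕ [-a,a] is a simple closed curve with positive orientation, γ'(0) = e^{iθ₀} with π/2 ≤ θ₀ < π, γ'(L) = e^{iθ_L} with π < θ_L ≤ 3π/2, and θ is the tangent angle lift of γ' with θ(0) = θ₀, then θ(L) = θ_L (the total rotation of γ ⊕ [-a,a], including the exterior angles at the two corners, equals exactly 2π). -/

import Mathlib

open Real Set Complex

/-- Real inner product on ℂ viewed as ℝ². -/
noncomputable def inner2 (x y : ℂ) : ℝ := x.re * y.re + x.im * y.im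

/-- Signed geodesic curvature of a unit-speed planar curve (J = multiplication by I). -/
noncomputable def curvU (γ : ℝ → ℂ) (t : ℝ) : ℝ :=
  inner2 (deriv (deriv γ) t) (Complex.I * deriv γ t)

/-- Signed geodesic curvature of a regular planar curve. -/
noncomputable def curvR (γ : ℝ → ℂ) (t : ℝ) : ℝ :=
  (‖deriv γ t‖ ^ 3)⁻¹ * inner2 (deriv (deriv γ) t) (Complex.I * deriv γ t)

/-- The closed curve γ ⊕ [-a,a]: γ on [0,L] followed by the segment from (-a,0) to (a,0). -/
noncomputable def concatSeg (γ : ℝ → ℂ) (L a : ℝ) : ℝ → ℂ :=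
  fun t => if t ≤ L then γ t else Complex.ofReal (-a + (t - L))

/-- A continuous function on an interval that starts below `c` and omits the value `c` in the
interior does not end above `c`. -/
theorem le_right_of_ne_on_Ioo {f : ℝ → ℝ} {p q c : ℝ} (hpq : p ≤ q)
    (hf : ContinuousOn f (Icc p q)) (hp : f p < c) (hne : ∀ x ∈ Ioo p q, f x ≠ c) : f q ≤ c := by
  by_contra! h
  obtain ⟨x, hx, hxc⟩ := intermediate_value_Ioo hpq hf ⟨hp, h⟩
  exact hne x hx hxc

theorem ge_right_of_ne_on_Ioo {f : ℝ → ℝ} {p q c : ℝ} (hpq : p ≤ q)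
    (hf : ContinuousOn f (Icc p q)) (hp : c < f p) (hne : ∀ x ∈ Ioo p q, f x ≠ c) : c ≤ f q := by
  by_contra! h
  obtain ⟨x, hx, hxc⟩ := intermediate_value_Ioo' hpq hf ⟨h, hp⟩
  exact hne x hx hxc

theorem ge_left_of_ne_on_Ioo {f : ℝ → ℝ} {p q c : ℝ} (hpq : p ≤ q)
    (hf : ContinuousOn f (Icc p q)) (hq : c < f q) (hne : ∀ x ∈ Ioo p q, f x ≠ c) : c ≤ f p := by
  by_contra! h
  obtain ⟨x, hx, hxc⟩ := intermediate_value_Ioo hpq hf ⟨h, hq⟩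
  exact hne x hx hxc

theorem exists_int_of_exp_mul_I_eq {x y : ℝ} (h : Complex.exp ((x : ℂ) * I) = Complex.exp ((y : ℂ) * I)) :
    ∃ n : ℤ, x = y + 2 * π * n := by
  obtain ⟨n, hn⟩ := Complex.exp_eq_exp_iff_exists_int.1 h
  refine ⟨n, ?_⟩
  have := congrArg Complex.im hn
  simp at this
  linarith

/-- The average of the derivative of `γ` over the interval with endpoints `p.1` and `p.2`. -/
noncomputable def secantSlope (γ : ℝ → ℂ) (p : ℝ × ℝ) : ℂ :=
  ∫ x in (0 : ℝ)..1, deriv γ (p.1 + x * (p.2 - p.1))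

theorem continuous_secantSlope {γ : ℝ → ℂ} (h : Continuous (deriv γ)) :
    Continuous (secantSlope γ) := by
  unfold secantSlope
  apply intervalIntegral.continuous_parametric_intervalIntegral_of_continuous'
  fun_prop

theorem secantSlope_self (γ : ℝ → ℂ) (t : ℝ) : secantSlope γ (t, t) = deriv γ t := by
  simp [secantSlope]

theorem sub_mul_secantSlope {γ : ℝ → ℂ} (hd : Differentiable ℝ γ) (h : Continuous (deriv γ))
    (s t : ℝ) : ((t - s : ℝ) : ℂ) * secantSlope γ (s, t) = γ t - γ s := by
  have key : ∫ x in (0 : ℝ)..1, ((t - s : ℝ) : ℂ) * deriv γ (s + x * (t - s)) =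
      γ (s + 1 * (t - s)) - γ (s + 0 * (t - s)) := by
    apply intervalIntegral.integral_eq_sub_of_hasDerivAt (f := fun x => γ (s + x * (t - s)))
    · intro x _
      have h1 : HasDerivAt (fun x : ℝ => s + x * (t - s)) (t - s) x := by
        simpa using ((hasDerivAt_id x).mul_const (t - s)).const_add s
      simpa [Function.comp_def] using (hd _).hasDerivAt.scomp x h1
    · apply Continuous.intervalIntegrable
      fun_prop
  rw [intervalIntegral.integral_const_mul] at key
  simpa [secantSlope] using key

/-- A nowhere vanishing continuous function on the plane has a continuous logarithm. -/
theorem exists_continuous_exp_eq {F : ℝ × ℝ → ℂ} (hF : Continuous F) (h0 : ∀ p, F p ≠ 0) :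
    ∃ f : ℝ × ℝ → ℂ, Continuous f ∧ ∀ p, Complex.exp (f p) = F p := by
  obtain ⟨f, ⟨-, hf⟩, -⟩ := isCoveringMapOn_exp.existsUnique_continuousMap_lifts ⟨F, hF⟩
    (a₀ := (0, 0)) (exp_log (h0 (0, 0))) h0
  exact ⟨f, map_continuous f, fun p => congrFun hf p⟩

/-- A simple arc with continuous tangent angle `θ` has a secant angle that is continuous on the
square and equal to `θ` on the diagonal. -/
theorem exists_secant_angle {γ : ℝ → ℂ} {θ : ℝ → ℝ} {L : ℝ} (hL : 0 ≤ L)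
    (hd : Differentiable ℝ γ) (hc : Continuous (deriv γ)) (hinj : InjOn γ (Icc 0 L))
    (hθ : ContinuousOn θ (Icc 0 L))
    (hlift : ∀ t ∈ Icc 0 L, deriv γ t = Complex.exp ((θ t : ℂ) * I)) :
    ∃ φ : ℝ × ℝ → ℝ, Continuous φ ∧ (∀ t ∈ Icc 0 L, φ (t, t) = θ t) ∧
      ∀ s ∈ Icc 0 L, ∀ t ∈ Icc 0 L, s < t →
        γ t - γ s = (‖γ t - γ s‖ : ℂ) * Complex.exp ((φ (s, t) : ℂ) * I) := by
  let c : ℝ → ℝ := fun x => projIcc 0 L hL x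
  have hcc : Continuous c := continuous_subtype_val.comp continuous_projIcc
  have hcm : ∀ x, c x ∈ Icc 0 L := fun x => (projIcc 0 L hL x).2
  have hce : ∀ x ∈ Icc 0 L, c x = x := fun x hx => by simp [c, projIcc_of_mem hL hx]
  have hsec := sub_mul_secantSlope hd hc
  obtain ⟨f, hf, hfe⟩ := exists_continuous_exp_eq
    (F := fun p => secantSlope γ (c p.1, c p.2))
    ((continuous_secantSlope hc).comp (by fun_prop)) (by
      rintro ⟨s, t⟩ h
      dsimp only at h
      by_cases hst : c s = c t
      · rw [hst, secantSlope_self, hlift _ (hcm t)] at h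
        exact Complex.exp_ne_zero _ h
      · have := hsec (c s) (c t)
        rw [h, mul_zero] at this
        exact hst (hinj (hcm s) (hcm t) (sub_eq_zero.1 this.symm).symm))
  have hfd : ∀ t ∈ Icc 0 L, ∃ n : ℤ, (f (t, t)).im = θ t + 2 * π * n := by
    intro t ht
    have h := hfe (t, t)
    rw [hce t ht, secantSlope_self, hlift t ht] at h
    obtain ⟨n, hn⟩ := Complex.exp_eq_exp_iff_exists_int.1 h
    refine ⟨n, ?_⟩
    have := congrArg Complex.im hn
    simp at this
    linarith
  have hconst : ∀ t ∈ Icc 0 L, (f (t, t)).im - θ t = (f (0, 0)).im - θ 0 := by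
    intro t ht
    have hcont : ContinuousOn (fun t => ((f (t, t)).im - θ t) / (2 * π)) (Icc 0 L) := by
      have : Continuous fun t => (f (t, t)).im := by fun_prop
      exact (this.continuousOn.sub hθ).div_const _
    have := isPreconnected_Icc.constant_of_mapsTo (T := range ((↑) : ℤ → ℝ))
      Int.isClosedEmbedding_coe_real.isEmbedding.isDiscrete_range hcont (by
      intro x hx
      obtain ⟨n, hn⟩ := hfd x hx
      refine ⟨n, ?_⟩
      have := pi_ne_zero
      simp only [hn]
      field_simp
      ring) ht (left_mem_Icc.2 hL)
    have hp := pi_ne_zero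
    field_simp at this
    exact this
  obtain ⟨n, hn⟩ := hfd 0 (left_mem_Icc.2 hL)
  refine ⟨fun p => (f p).im - 2 * π * n, by fun_prop, ?_, ?_⟩
  · intro t ht
    have := hconst t ht
    dsimp only
    linarith
  · intro s hs t ht hst
    have h := hsec s t
    have h' := hfe (s, t)
    simp only [hce s hs, hce t ht] at h'
    rw [← h', ← Complex.re_add_im (f (s, t)), Complex.exp_add, ← Complex.ofReal_exp, ← mul_assoc,
      ← Complex.ofReal_mul] at h
    have hn : ‖γ t - γ s‖ = (t - s) * Real.exp (f (s, t)).re := by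
      rw [← h, norm_mul, Complex.norm_exp_ofReal_mul_I, mul_one, Complex.norm_real,
        Real.norm_of_nonneg]
      have := sub_pos.2 hst
      positivity
    rw [hn, ← h]
    congr 1
    rw [Complex.exp_eq_exp_iff_exists_int]
    refine ⟨n, ?_⟩
    push_cast
    ring

/-- The tangent angle of a curve of nonnegative curvature is nondecreasing. -/
theorem tangent_angle_monotoneOn {γ : ℝ → ℂ} {θ : ℝ → ℝ} {L : ℝ}
    (hd : Differentiable ℝ (deriv γ)) (hcurv : ∀ t ∈ Icc 0 L, 0 ≤ curvU γ t)
    (hθ : ContinuousOn θ (Icc 0 L))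
    (hlift : ∀ t ∈ Icc 0 L, deriv γ t = Complex.exp ((θ t : ℂ) * I)) :
    MonotoneOn θ (Icc 0 L) := by
  have key : ∀ t ∈ Ioo 0 L, HasDerivAt θ (curvU γ t) t := by
    intro t ht
    have htm := Ioo_subset_Icc_self ht
    have hre : HasDerivAt (fun x => (deriv γ x).re) (deriv (deriv γ) t).re t :=
      Complex.reCLM.hasFDerivAt.comp_hasDerivAt t (hd t).hasDerivAt
    have him : HasDerivAt (fun x => (deriv γ x).im) (deriv (deriv γ) t).im t :=
      Complex.imCLM.hasFDerivAt.comp_hasDerivAt t (hd t).hasDerivAt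
    have hg := (him.mul_const (deriv γ t).re).sub (hre.mul_const (deriv γ t).im)
    have hg0 : (deriv γ t).im * (deriv γ t).re - (deriv γ t).re * (deriv γ t).im = 0 := by ring
    have ha : HasDerivAt Real.arcsin 1
        ((deriv γ t).im * (deriv γ t).re - (deriv γ t).re * (deriv γ t).im) := by
      rw [hg0]
      simpa using Real.hasDerivAt_arcsin (x := 0) (by norm_num) (by norm_num)
    have hcomp := (ha.comp t hg).add_const (θ t)
    have hθt : ContinuousAt θ t := hθ.continuousAt (Icc_mem_nhds ht.1 ht.2)
    have hnear : ∀ᶠ x in nhds t, θ x - θ t ∈ Ioo (-(π / 2)) (π / 2) := by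
      have : ContinuousAt (fun x => θ x - θ t) t := hθt.sub continuousAt_const
      apply this.eventually_mem
      apply Ioo_mem_nhds <;> simp [pi_pos]
    have heq : θ =ᶠ[nhds t] fun x => Real.arcsin
        ((deriv γ x).im * (deriv γ t).re - (deriv γ x).re * (deriv γ t).im) + θ t := by
      filter_upwards [hnear, Icc_mem_nhds ht.1 ht.2] with x hx hxm
      rw [hlift x hxm, hlift t htm, Complex.exp_ofReal_mul_I_re, Complex.exp_ofReal_mul_I_re,
        Complex.exp_ofReal_mul_I_im, Complex.exp_ofReal_mul_I_im, ← Real.sin_sub,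
        Real.arcsin_sin hx.1.le hx.2.le]
      ring
    have hcurv_eq : curvU γ t = 1 * ((deriv (deriv γ) t).im * (deriv γ t).re -
        (deriv (deriv γ) t).re * (deriv γ t).im) := by
      simp [curvU, inner2]
      ring
    rw [hcurv_eq]
    exact hcomp.congr_of_eventuallyEq heq
  refine monotoneOn_of_deriv_nonneg (convex_Icc 0 L) hθ ?_ ?_
  · rw [interior_Icc]
    exact fun t ht => (key t ht).differentiableAt.differentiableWithinAt
  · rw [interior_Icc]
    intro t ht
    rw [(key t ht).deriv]
    exact hcurv t (Ioo_subset_Icc_self ht)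

theorem lt_of_two_pi_mul_lt {m n : ℤ} (h : 2 * π * (m : ℝ) < 2 * π * (n : ℝ)) : m < n := by
  exact_mod_cast lt_of_mul_lt_mul_left h two_pi_pos.le

theorem sin_add_two_pi_mul_int {x : ℝ} (n : ℤ) : Real.sin (x + 2 * π * n) = Real.sin x := by
  rw [← Real.sin_add_int_mul_two_pi x n]
  ring_nf

/-- Two angle functions with a common value, one with nonnegative sine and one with nonpositive
sine, end up less than `2π` apart. -/
theorem sub_lt_two_pi_of_sin_nonneg_of_sin_nonpos {f g : ℝ → ℝ} {m L : ℝ} (h0m : 0 < m)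
    (hmL : m < L) (hf : ContinuousOn f (Icc m L)) (hg : ContinuousOn g (Icc 0 m))
    (hfg : f m = g m) (hm : Real.sin (f m) = 0)
    (hfs : ∀ t ∈ Ioo m L, 0 ≤ Real.sin (f t)) (hgs : ∀ t ∈ Ioo 0 m, Real.sin (g t) ≤ 0)
    (hfL : 0 < Real.sin (f L)) (hg0 : Real.sin (g 0) < 0) : f L - g 0 < 2 * π := by
  have hpi := pi_pos
  obtain ⟨N, hN⟩ := Real.sin_eq_zero_iff.1 hm
  rcases Int.even_or_odd' N with ⟨n, rfl | rfl⟩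
  · push_cast at hN
    have hfm : f L ≤ 3 * π / 2 + 2 * π * n := by
      refine le_right_of_ne_on_Ioo hmL.le hf (by linarith) fun x hx h => ?_
      have := hfs x hx
      rw [h, sin_add_two_pi_mul_int, show 3 * π / 2 = π / 2 + π by ring, Real.sin_add_pi,
        Real.sin_pi_div_two] at this
      linarith
    have hgm : -(3 * π / 2) + 2 * π * n ≤ g 0 := by
      refine ge_left_of_ne_on_Ioo h0m.le hg (by linarith) fun x hx h => ?_
      have := hgs x hx
      rw [h, sin_add_two_pi_mul_int, show -(3 * π / 2) = -(π / 2 + π) by ring, Real.sin_neg,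
        Real.sin_add_pi, Real.sin_pi_div_two] at this
      linarith
    have hf' : f L < π + 2 * π * n := by
      by_contra! h
      have h2 : 0 ≤ Real.sin (f L - (π + 2 * π * n)) :=
        Real.sin_nonneg_of_nonneg_of_le_pi (by linarith) (by linarith)
      have h3 := sin_add_two_pi_mul_int (x := f L - (π + 2 * π * n) + π) n
      rw [Real.sin_add_pi] at h3
      ring_nf at h2 h3 hfL
      linarith
    have hg' : -π + 2 * π * n < g 0 := by
      by_contra! h
      have h2 : Real.sin (g 0 - (-π + 2 * π * n)) ≤ 0 :=
        Real.sin_nonpos_of_nonpos_of_neg_pi_le (by linarith) (by linarith)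
      have h3 := sin_add_two_pi_mul_int (x := g 0 - (-π + 2 * π * n) - π) n
      rw [Real.sin_sub_pi] at h3
      ring_nf at h2 h3 hg0
      linarith
    linarith
  · push_cast at hN
    have hfm : f L ≤ 3 * π / 2 + 2 * π * n := by
      refine le_right_of_ne_on_Ioo hmL.le hf (by linarith) fun x hx h => ?_
      have := hfs x hx
      rw [h, sin_add_two_pi_mul_int, show 3 * π / 2 = π / 2 + π by ring, Real.sin_add_pi,
        Real.sin_pi_div_two] at this
      linarith
    have hgm : π / 2 + 2 * π * n ≤ g 0 := by
      refine ge_left_of_ne_on_Ioo h0m.le hg (by linarith) fun x hx h => ?_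
      have := hgs x hx
      rw [h, sin_add_two_pi_mul_int, Real.sin_pi_div_two] at this
      linarith
    linarith

theorem stmt2 (a L θ₀ θL : ℝ) (ha : 0 < a) (hL : 0 < L) (γ : ℝ → ℂ) (θ : ℝ → ℝ)
    (hγ : ContDiff ℝ 2 γ)
    (hunit : ∀ t ∈ Icc 0 L, ‖deriv γ t‖ = 1)
    (hcurv : ∀ t ∈ Icc 0 L, 0 < curvU γ t)
    (h0 : γ 0 = (a : ℂ)) (h1 : γ L = (-a : ℂ))
    (hsimple : Set.InjOn (concatSeg γ L a) (Ico 0 (L + 2 * a)))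
    (hθ0 : π / 2 ≤ θ₀) (hθ0' : θ₀ < π) (hθL : π < θL) (hθL' : θL ≤ 3 * π / 2)
    (hd0 : deriv γ 0 = Complex.exp ((θ₀ : ℂ) * Complex.I))
    (hdL : deriv γ L = Complex.exp ((θL : ℂ) * Complex.I))
    (hθcont : ContinuousOn θ (Icc 0 L))
    (hθlift : ∀ t ∈ Icc 0 L, deriv γ t = Complex.exp ((θ t : ℂ) * Complex.I))
    (hθinit : θ 0 = θ₀) :
    θ L = θL := by
  have hpi := pi_pos
  have m0 : (0 : ℝ) ∈ Icc 0 L := left_mem_Icc.2 hL.le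
  have mL : L ∈ Icc 0 L := right_mem_Icc.2 hL.le
  have hinj : InjOn γ (Icc 0 L) := by
    intro s hs t ht hst
    refine hsimple ⟨hs.1, by linarith [hs.2]⟩ ⟨ht.1, by linarith [ht.2]⟩ ?_
    simpa [concatSeg, hs.2, ht.2] using hst
  have hseg : ∀ t ∈ Ioo 0 L, ∀ x ∈ Ioo (-a) a, γ t ≠ (x : ℂ) := by
    intro t ht x hx h
    have hxL : ¬ L + (x + a) ≤ L := by linarith [hx.1]
    have := hsimple (x₁ := t) (x₂ := L + (x + a)) ⟨ht.1.le, by linarith [ht.2]⟩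
      ⟨by linarith [hx.1], by linarith [hx.2]⟩ (by
        rw [concatSeg, if_pos ht.2.le, concatSeg, if_neg hxL, h]
        congr 1
        ring)
    linarith [ht.2, hx.1]
  have hγd : Differentiable ℝ γ := hγ.differentiable (by norm_num)
  have hγ1 : ContDiff ℝ 1 (deriv γ) := ((contDiff_succ_iff_deriv (n := 1)).1 hγ).2.2
  obtain ⟨φ, hφ, hdiag, hsec⟩ :=
    exists_secant_angle hL.le hγd hγ1.continuous hinj hθcont hθlift
  have hpos : ∀ s ∈ Icc 0 L, ∀ t ∈ Icc 0 L, s < t → 0 < ‖γ t - γ s‖ := fun s hs t ht hst =>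
    norm_pos_iff.2 (sub_ne_zero.2 fun h => hst.ne' (hinj ht hs h))
  have hsin : ∀ s ∈ Icc 0 L, ∀ t ∈ Icc 0 L, s < t →
      (γ t).im - (γ s).im = ‖γ t - γ s‖ * Real.sin (φ (s, t)) := by
    intro s hs t ht hst
    have := congrArg Complex.im (hsec s hs t ht hst)
    rwa [Complex.im_ofReal_mul, Complex.exp_ofReal_mul_I_im, Complex.sub_im] at this
  obtain ⟨j, hj⟩ : ∃ j : ℤ, φ (0, L) = π + 2 * π * j := by
    apply exists_int_of_exp_mul_I_eq
    have h := hsec 0 m0 L mL hL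
    have hn : ‖γ L - γ 0‖ = 2 * a := by
      rw [h0, h1, show (-a - a : ℂ) = ((-(2 * a) : ℝ) : ℂ) by push_cast; ring, Complex.norm_real,
        norm_neg, Real.norm_of_nonneg (by positivity)]
    rw [hn, h0, h1] at h
    rw [Complex.exp_pi_mul_I]
    have ha' : ((2 * a : ℝ) : ℂ) ≠ 0 := by
      rw [Complex.ofReal_ne_zero]
      positivity
    apply mul_left_cancel₀ ha'
    rw [← h]
    push_cast
    ring
  obtain ⟨k, hk⟩ : ∃ k : ℤ, θ L = θL + 2 * π * k :=
    exists_int_of_exp_mul_I_eq ((hθlift L mL).symm.trans hdL)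
  have hmono := tangent_angle_monotoneOn (hγ1.differentiable (by norm_num))
    (fun t ht => (hcurv t ht).le) hθcont hθlift m0 mL hL.le
  have hw : ∀ t ∈ Ioo 0 L, ∀ n : ℤ, φ (0, t) - φ (t, L) ≠ 2 * π * n := by
    intro t ht n hn
    have htm := Ioo_subset_Icc_self ht
    have e1 := hsec 0 m0 t htm ht.1
    have e2 := hsec t htm L mL ht.2
    have p1 := hpos 0 m0 t htm ht.1
    have p2 := hpos t htm L mL ht.2
    set r₁ := ‖γ t - γ 0‖
    set r₂ := ‖γ L - γ t‖
    have he : Complex.exp ((φ (0, t) : ℂ) * I) = Complex.exp ((φ (t, L) : ℂ) * I) := by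
      rw [Complex.exp_eq_exp_iff_exists_int]
      refine ⟨n, ?_⟩
      rw [show φ (0, t) = φ (t, L) + 2 * π * n by linarith]
      push_cast
      ring
    rw [he, h0] at e1
    rw [h1] at e2
    have hr : ((r₁ + r₂ : ℝ) : ℂ) ≠ 0 := by
      rw [Complex.ofReal_ne_zero]
      positivity
    refine hseg t ht (a * (r₂ - r₁) / (r₁ + r₂)) ⟨?_, ?_⟩ ?_
    · rw [lt_div_iff₀ (by positivity)]
      nlinarith
    · rw [div_lt_iff₀ (by positivity)]
      nlinarith
    · rw [Complex.ofReal_div, eq_div_iff hr]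
      push_cast
      linear_combination (r₂ : ℂ) * e1 - (r₁ : ℂ) * e2
  have hwc : Continuous fun t => φ (0, t) - φ (t, L) := by fun_prop
  have hφ0 : φ (0, 0) = θ₀ := by rw [hdiag 0 m0, hθinit]
  have hφL : φ (L, L) = θL + 2 * π * k := by rw [hdiag L mL, hk]
  have hub : ∀ t ∈ Icc 0 L, φ (0, t) - φ (t, L) ≤ 2 * π * (-j : ℤ) := by
    intro t ht
    refine le_right_of_ne_on_Ioo (f := fun t => φ (0, t) - φ (t, L)) ht.1 hwc.continuousOn ?_
      fun x hx => hw x ⟨hx.1, hx.2.trans_le ht.2⟩ _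
    push_cast
    linarith
  have hlb : 2 * π * (-j - 1 : ℤ) ≤ φ (0, L) - φ (L, L) := by
    refine ge_right_of_ne_on_Ioo (f := fun t => φ (0, t) - φ (t, L)) hL.le hwc.continuousOn ?_
      fun x hx => hw x hx _
    push_cast
    linarith
  have hkj : k = 2 * j := by
    have hub' := hub L mL
    have c1 : 2 * j - 1 < k := lt_of_two_pi_mul_lt (by push_cast at *; linarith)
    have c2 : k < 2 * j + 1 := lt_of_two_pi_mul_lt (by push_cast at *; linarith)
    omega
  have hk0 : -1 < k := lt_of_two_pi_mul_lt (by push_cast; linarith)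
  suffices hj1 : j < 1 by
    have : k = 0 := by omega
    simpa [this] using hk
  obtain ⟨m, hm, hmin⟩ := isCompact_Icc.exists_isMinOn ⟨0, m0⟩
    (Complex.continuous_im.comp hγd.continuous).continuousOn
  have hmin' : ∀ t ∈ Icc 0 L, (γ m).im ≤ (γ t).im := fun t ht => hmin ht
  by_cases hneg : (γ m).im < 0
  · have hm0 : 0 < m := hm.1.lt_of_ne (by rintro rfl; simp [h0] at hneg)
    have hmL : m < L := hm.2.lt_of_ne (by rintro rfl; simp [h1] at hneg)
    have hdm : (deriv γ m).im = 0 := by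
      have hloc : IsLocalMin (fun t => (γ t).im) m := hmin.isLocalMin (Icc_mem_nhds hm0 hmL)
      exact hloc.hasDerivAt_eq_zero
        (Complex.imCLM.hasFDerivAt.comp_hasDerivAt m (hγd m).hasDerivAt)
    have hsm : Real.sin (φ (m, m)) = 0 := by
      rw [hdiag m hm, ← Complex.exp_ofReal_mul_I_im, ← hθlift m hm, hdm]
    have key := sub_lt_two_pi_of_sin_nonneg_of_sin_nonpos (f := fun t => φ (m, t))
      (g := fun t => φ (t, m)) hm0 hmL (by fun_prop) (by fun_prop) rfl hsm
      (fun t ht => by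
        have htm : t ∈ Icc 0 L := ⟨hm0.le.trans ht.1.le, ht.2.le⟩
        refine nonneg_of_mul_nonneg_right ?_ (hpos m hm t htm ht.1)
        rw [← hsin m hm t htm ht.1]
        linarith [hmin' t htm])
      (fun t ht => by
        have htm : t ∈ Icc 0 L := ⟨ht.1.le, ht.2.le.trans hm.2⟩
        refine nonpos_of_mul_nonpos_right ?_ (hpos t htm m hm ht.2)
        rw [← hsin t htm m hm ht.2]
        linarith [hmin' t htm])
      (by
        refine pos_of_mul_pos_right ?_ (hpos m hm L mL hmL).le
        rw [← hsin m hm L mL hmL, h1]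
        simpa using hneg)
      (by
        refine neg_of_mul_neg_right ?_ (hpos 0 m0 m hm hm0).le
        rw [← hsin 0 m0 m hm hm0, h0]
        simpa using hneg)
    have := hub m hm
    apply lt_of_two_pi_mul_lt
    push_cast at *
    linarith
  · have hα : φ (0, L) ≤ 3 * π / 2 := by
      refine le_right_of_ne_on_Ioo (f := fun t => φ (0, t)) hL.le (by fun_prop)
        (by linarith) fun t ht h => ?_
      have htm := Ioo_subset_Icc_self ht
      have h2 := hsin 0 m0 t htm ht.1
      have h3 := hpos 0 m0 t htm ht.1
      rw [h, show 3 * π / 2 = π / 2 + π by ring, Real.sin_add_pi, Real.sin_pi_div_two, h0,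
        Complex.ofReal_im] at h2
      rw [h0] at h3
      linarith [hmin' t htm]
    apply lt_of_two_pi_mul_lt
    push_cast
    linarith
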